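/- Under the equal-load cyclic-shift routing for conservative k-of-n testing, if all processors have the same rate limit r, then assigning r·(1-p_{i-1})/α units of flow to strategy T_k(π_i) for each i (with p_0 := p_n and α = ∑_{t=1}^k P(Z ≥ t), Z = total number of zeros) saturates every processor, hence is an optimal routing. -/

import Mathlib

open Finset

noncomputable def wt {n : ℕ} (p : Fin n → ℝ) (x : Fin n → Bool) : ℝ :=
  ∏ i, if x i then p i else 1 - p i

open scoped Classical in
/-- Probability of an event under the product Bernoulli distribution with parameters `p`. -/
noncomputable def pr {n : ℕ} (p : Fin n → ℝ) (E : (Fin n → Bool) → Prop) : ℝ :=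
  ∑ x ∈ Finset.univ.filter E, wt p x

/-- Number of zeros (failed tests) in an outcome vector. -/
def zeros {n : ℕ} (x : Fin n → Bool) : ℕ := ∑ i, if x i then 0 else 1

/-- Binary decision trees over `n` tests. -/
inductive DTree (n : ℕ) : Type
  | leaf (b : Bool) : DTree n
  | node (i : Fin n) (l r : DTree n) : DTree n

def DTree.eval {n : ℕ} : DTree n → (Fin n → Bool) → Bool
  | .leaf b, _ => b
  | .node i l r, x => if x i then DTree.eval r x else DTree.eval l x

/-- The set of tests performed on item `x` by strategy `T`. -/
def DTree.tests {n : ℕ} : DTree n → (Fin n → Bool) → Finset (Fin n)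
  | .leaf _, _ => ∅
  | .node i l r, x => insert i (if x i then DTree.tests r x else DTree.tests l x)

/-- The number of tests (path length) performed on item `x` by strategy `T`. -/
def DTree.depthOn {n : ℕ} : DTree n → (Fin n → Bool) → ℕ
  | .leaf _, _ => 0
  | .node i l r, x => (if x i then DTree.depthOn r x else DTree.depthOn l x) + 1

/-- `gprob p T i` : probability that test `i` is performed on a random item under strategy `T`. -/
noncomputable def gprob {n : ℕ} (p : Fin n → ℝ) (T : DTree n) (i : Fin n) : ℝ :=
  pr p (fun x => i ∈ T.tests x)

/-- A conservative `k`-of-`n` strategy: tests along each path are distinct, the strategy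
computes the `k`-of-`n` function, items with fewer than `k` zeros undergo all `n` tests,
and items with at least `k` zeros are tested exactly until `k` zeros are observed. -/
def Conservative {n : ℕ} (k : ℕ) (T : DTree n) : Prop :=
  (∀ x, T.depthOn x = (T.tests x).card) ∧
  (∀ x : Fin n → Bool, T.eval x = decide (zeros x < k)) ∧
  (∀ x, zeros x < k → T.tests x = Finset.univ) ∧
  (∀ x, k ≤ zeros x → ((T.tests x).filter (fun i => x i = false)).card = k)

/-- The conservative strategy that performs the listed tests in order until `k` zeros
have been observed or the list is exhausted. -/
def permTree (n : ℕ) : ℕ → List (Fin n) → DTree n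
  | 0, _ => .leaf false
  | _ + 1, [] => .leaf true
  | k + 1, i :: rest => .node i (permTree n k rest) (permTree n (k + 1) rest)

/-- The conservative `k`-of-`n` strategy following the order `π 0, π 1, …`. -/
def permStrat {n : ℕ} (k : ℕ) (π : Equiv.Perm (Fin n)) : DTree n :=
  permTree n k ((List.finRange n).map π)

lemma wt_pos {n : ℕ} {p : Fin n → ℝ} (hp : ∀ i, 0 < p i ∧ p i < 1) (x : Fin n → Bool) :
    0 < wt p x :=
  Finset.prod_pos fun i _ => by
    split_ifs
    · exact (hp i).1
    · linarith [(hp i).2]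

lemma zeros_eq_card {n : ℕ} (x : Fin n → Bool) :
    zeros x = (Finset.univ.filter fun i => x i = false).card := by
  rw [zeros, Finset.card_filter]
  refine Finset.sum_congr rfl fun i _ => ?_
  cases x i <;> rfl

open scoped Classical in
lemma pr_eq_sum_ite {n : ℕ} (p : Fin n → ℝ) (E : (Fin n → Bool) → Prop) :
    pr p E = ∑ x, if E x then wt p x else 0 := by
  rw [pr, Finset.sum_filter]

open scoped Classical in
lemma sum_pr {n : ℕ} {ι : Type*} (S : Finset ι) (p : Fin n → ℝ)
    (E : ι → (Fin n → Bool) → Prop) :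
    ∑ t ∈ S, pr p (E t) = ∑ x, wt p x * ((S.filter fun t => E t x).card : ℝ) := by
  rw [Finset.sum_congr rfl fun t _ => pr_eq_sum_ite p (E t), Finset.sum_comm]
  refine Finset.sum_congr rfl fun x _ => ?_
  rw [← Finset.sum_filter, Finset.sum_const, nsmul_eq_mul, mul_comm]

/-- The tail-sum formula for the expectation of `min Z k`. -/
lemma sum_pr_le_zeros {n : ℕ} (k : ℕ) (p : Fin n → ℝ) :
    ∑ t ∈ Finset.Icc 1 k, pr p (fun x => t ≤ zeros x) =
      ∑ x, wt p x * ((min (zeros x) k : ℕ) : ℝ) := by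
  classical
  rw [sum_pr]
  refine Finset.sum_congr rfl fun x _ => ?_
  have : (Finset.Icc 1 k).filter (fun t => t ≤ zeros x) = Finset.Icc 1 (min (zeros x) k) := by
    ext t
    simp only [Finset.mem_filter, Finset.mem_Icc]
    omega
  have hcard := congrArg Finset.card this
  rw [Nat.card_Icc, Nat.add_sub_cancel] at hcard
  rw [← hcard]
  congr!

lemma sum_pr_le_zeros_pos {n k : ℕ} [NeZero n] (hk : 1 ≤ k) {p : Fin n → ℝ}
    (hp : ∀ i, 0 < p i ∧ p i < 1) :
    0 < ∑ t ∈ Finset.Icc 1 k, pr p (fun x => t ≤ zeros x) := by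
  rw [sum_pr_le_zeros]
  refine Finset.sum_pos' (fun x _ => mul_nonneg (wt_pos hp x).le (Nat.cast_nonneg _))
    ⟨fun _ => false, Finset.mem_univ _, mul_pos (wt_pos hp _) ?_⟩
  have hn : 0 < n := Nat.pos_of_ne_zero (NeZero.ne n)
  have hz : zeros (fun _ : Fin n => false) = n := by simp [zeros]
  rw [hz]
  exact_mod_cast lt_min hn hk

/-- An event that does not depend on coordinate `i` is independent of `x i = false`. -/
lemma one_sub_mul_pr {n : ℕ} (p : Fin n → ℝ) (i : Fin n) (A : (Fin n → Bool) → Prop)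
    (hA : ∀ x b, A (Function.update x i b) ↔ A x) :
    (1 - p i) * pr p A = pr p (fun x => A x ∧ x i = false) := by
  classical
  rw [← sub_eq_zero, pr_eq_sum_ite, pr_eq_sum_ite, Finset.mul_sum, ← Finset.sum_sub_distrib]
  refine Finset.sum_involution (fun x _ => Function.update x i (!x i)) ?_ ?_ ?_ ?_
  · intro x _
    have h1 : ∀ y : Fin n → Bool,
        wt p y = (if y i then p i else 1 - p i) *
          ∏ j ∈ Finset.univ.erase i, if y j then p j else 1 - p j := fun y =>
      (Finset.mul_prod_erase _ _ (Finset.mem_univ i)).symm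
    have h2 : (∏ j ∈ Finset.univ.erase i,
          if Function.update x i (!x i) j then p j else 1 - p j) =
        ∏ j ∈ Finset.univ.erase i, if x j then p j else 1 - p j :=
      Finset.prod_congr rfl fun j hj => by
        rw [Function.update_of_ne (Finset.ne_of_mem_erase hj)]
    rw [h1 x, h1 (Function.update x i (!x i)), h2]
    simp only [hA, Function.update_self]
    by_cases hx : A x
    · cases x i <;> simp [hx] <;> ring
    · simp [hx]
  · intro x _ _ h
    have := congrFun h i
    simp at this
  · intro x _
    exact Finset.mem_univ _
  · intro x _
    simp

lemma DTree.mem_tests_update {n : ℕ} (T : DTree n) (i : Fin n) (x : Fin n → Bool) (b : Bool) :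
    i ∈ T.tests (Function.update x i b) ↔ i ∈ T.tests x := by
  induction T with
  | leaf c => rfl
  | node j l r ihl ihr =>
    by_cases h : i = j
    · simp [DTree.tests, h]
    · simp only [DTree.tests, Finset.mem_insert, h, false_or,
        Function.update_of_ne (Ne.symm h)]
      cases x j
      · simpa using ihl
      · simpa using ihr

/-- The expected number of zeros found by a conservative strategy is `∑ t ∈ [1, k], P(Z ≥ t)`. -/
lemma Conservative.sum_gprob {n k : ℕ} {T : DTree n} (hT : Conservative k T) (p : Fin n → ℝ) :
    ∑ i, (1 - p i) * gprob p T i = ∑ t ∈ Finset.Icc 1 k, pr p (fun x => t ≤ zeros x) := by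
  classical
  rw [sum_pr_le_zeros]
  simp only [gprob]
  rw [Finset.sum_congr rfl fun i _ =>
    one_sub_mul_pr p i (fun x => i ∈ T.tests x) (T.mem_tests_update i), sum_pr]
  refine Finset.sum_congr rfl fun x _ => ?_
  congr 2
  have key : ((T.tests x).filter fun i => x i = false).card = min (zeros x) k := by
    rcases lt_or_ge (zeros x) k with h | h
    · rw [hT.2.2.1 x h, ← zeros_eq_card, min_eq_left h.le]
    · rw [hT.2.2.2 x h, min_eq_right h]
  rw [← key]
  congr 1
  ext i
  simp

lemma mem_tests_permTree_append {n : ℕ} (x : Fin n → Bool) (m : Fin n) (b : List (Fin n)) :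
    ∀ (a : List (Fin n)) (k : ℕ), m ∉ a →
      (m ∈ (permTree n k (a ++ m :: b)).tests x ↔ a.countP (fun i => x i = false) < k)
  | _, 0, _ => by simp [permTree, DTree.tests]
  | [], k + 1, _ => by simp [permTree, DTree.tests]
  | j :: a, k + 1, h => by
    have hj : m ≠ j := fun e => h (by simp [e])
    have ha : m ∉ a := fun e => h (by simp [e])
    have ih := mem_tests_permTree_append x m b a
    simp only [List.cons_append, permTree, DTree.tests, Finset.mem_insert, hj, false_or]
    cases hx : x j
    · simpa [hx] using ih k ha
    · simpa [hx] using ih (k + 1) ha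

lemma mem_tests_permStrat {n k : ℕ} (π : Equiv.Perm (Fin n)) (x : Fin n → Bool) (d : Fin n) :
    π d ∈ (permStrat k π).tests x ↔
      (Finset.univ.filter fun j => j < d ∧ x (π j) = false).card < k := by
  obtain ⟨a, b, hab⟩ := List.append_of_mem (List.mem_finRange d)
  have hs : (a ++ d :: b).Pairwise (· < ·) := hab ▸ List.pairwise_lt_finRange n
  rw [List.pairwise_append, List.pairwise_cons] at hs
  obtain ⟨haa, ⟨hdb, -⟩, hadb⟩ := hs
  have hmem : ∀ j, j ∈ a ↔ j < d := by
    refine fun j => ⟨fun hj => hadb j hj d (by simp), fun hj => ?_⟩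
    have h := List.mem_finRange j
    rw [hab, List.mem_append, List.mem_cons] at h
    rcases h with h | h | h
    · exact h
    · exact absurd h hj.ne
    · exact absurd (hdb j h) hj.asymm
  have hnot : π d ∉ a.map π := by
    simp [hmem]
  rw [permStrat, hab, List.map_append, List.map_cons,
    mem_tests_permTree_append x (π d) (b.map π) (a.map π) k hnot, List.countP_map,
    List.countP_eq_length_filter]
  have hnd : (a.filter ((fun i => decide (x i = false)) ∘ π)).Nodup :=
    (haa.imp fun h => h.ne).filter _
  rw [← List.toFinset_card_of_nodup hnd]
  have : (a.filter ((fun i => decide (x i = false)) ∘ π)).toFinset =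
      Finset.univ.filter fun j => j < d ∧ x (π j) = false := by
    ext j
    simp [hmem]
  rw [this]

lemma card_filter_rank_lt {ι : Type*} [LinearOrder ι] (k : ℕ) (F : Finset ι) :
    (F.filter fun d => (F.filter fun i => i < d).card < k).card = min F.card k := by
  induction F using Finset.induction_on_max with
  | empty => simp
  | insert a F hF ih =>
    have ha : a ∉ F := fun h => lt_irrefl a (hF a h)
    have h1 : (insert a F).filter (fun i => i < a) = F := by
      ext i
      simp only [Finset.mem_filter, Finset.mem_insert]
      exact ⟨fun h => h.1.resolve_left h.2.ne, fun h => ⟨Or.inr h, hF i h⟩⟩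
    have h2 : F.filter (fun d => ((insert a F).filter fun i => i < d).card < k) =
        F.filter fun d => (F.filter fun i => i < d).card < k := by
      refine Finset.filter_congr fun d hd => ?_
      rw [Finset.filter_insert, if_neg (hF d hd).asymm]
    rw [Finset.filter_insert, h1, h2, Finset.card_insert_of_notMem ha]
    split_ifs with h
    · rw [Finset.card_insert_of_notMem (by simp [ha]), ih]
      omega
    · rw [ih]
      omega

/-- Counting zeros among `m - d, …, m - 1` upwards or downwards gives the same number. -/
lemma card_window {n : ℕ} [NeZero n] (x : Fin n → Bool) (m d : Fin n) :
    (Finset.univ.filter fun j => j < d ∧ x (m - d + j) = false).card =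
      (Finset.univ.filter fun i => i < d ∧ x (m - 1 - i) = false).card := by
  have hval : ∀ j : Fin n, j < d → ∃ i : Fin n, i < d ∧ d - 1 - j = i ∧ d = i + j + 1 := by
    intro j hj
    have hj' : j.val < d.val := hj
    have hd := d.isLt
    have hi : d = (⟨d.val - 1 - j.val, by omega⟩ : Fin n) + j + 1 := by
      apply Fin.ext
      rw [Fin.val_add, Fin.val_add, Fin.val_one', ← Nat.add_mod]
      have : d.val - 1 - j.val + j.val + 1 = d.val := by omega
      simp only [this]
      exact (Nat.mod_eq_of_lt hd).symm
    refine ⟨_, ?_, ?_, hi⟩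
    · rw [Fin.lt_def]
      simp only
      omega
    · nth_rewrite 1 [hi]
      abel
  have haux : ∀ j, j < d → d - 1 - j < d := fun j hj => by
    obtain ⟨i, hi, he, -⟩ := hval j hj
    rwa [he]
  have h1 : ∀ j, m - 1 - (d - 1 - j) = m - d + j := fun j => by abel
  have h2 : ∀ j, m - d + (d - 1 - j) = m - 1 - j := fun j => by abel
  refine Finset.card_nbij' (fun j => d - 1 - j) (fun j => d - 1 - j) ?_ ?_ ?_ ?_
  · intro j hj
    simp only [Finset.coe_filter, Finset.mem_univ, true_and, Set.mem_ofPred_eq] at hj ⊢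
    exact ⟨haux j hj.1, by rw [h1]; exact hj.2⟩
  · intro j hj
    simp only [Finset.coe_filter, Finset.mem_univ, true_and, Set.mem_ofPred_eq] at hj ⊢
    exact ⟨haux j hj.1, by rw [h2]; exact hj.2⟩
  · intro j _
    simp
  · intro j _
    simp

/-- The load on processor `m` under the cyclic-shift routing with weights `1 - p (s - 1)`. -/
lemma sum_gprob_cyclic {n k : ℕ} [NeZero n] (p : Fin n → ℝ) (m : Fin n) :
    ∑ s : Fin n, (1 - p (s - 1)) * gprob p (permStrat k (Equiv.addLeft s)) m =
      ∑ t ∈ Finset.Icc 1 k, pr p (fun x => t ≤ zeros x) := by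
  classical
  have hterm : ∀ d : Fin n,
      (1 - p (m - d - 1)) * gprob p (permStrat k (Equiv.addLeft (m - d))) m =
        pr p (fun x => (Finset.univ.filter fun i => i < d ∧ x (m - 1 - i) = false).card < k ∧
          x (m - 1 - d) = false) := by
    intro d
    have hg : gprob p (permStrat k (Equiv.addLeft (m - d))) m =
        pr p (fun x =>
          (Finset.univ.filter fun i => i < d ∧ x (m - 1 - i) = false).card < k) := by
      rw [gprob]
      congr 1
      funext x
      have h := mem_tests_permStrat (k := k) (Equiv.addLeft (m - d)) x d
      simp only [Equiv.coe_addLeft, sub_add_cancel] at h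
      exact propext (h.trans (card_window x m d ▸ Iff.rfl))
    rw [hg, show m - d - 1 = m - 1 - d by abel, one_sub_mul_pr]
    intro x b
    have : (Finset.univ.filter fun i =>
          i < d ∧ Function.update x (m - 1 - d) b (m - 1 - i) = false) =
        Finset.univ.filter fun i => i < d ∧ x (m - 1 - i) = false := by
      refine Finset.filter_congr fun i _ => and_congr_right fun hi => ?_
      rw [Function.update_of_ne fun e => hi.ne (sub_right_injective e)]
    rw [this]
  rw [← (Equiv.subLeft m).sum_comp, sum_pr_le_zeros]
  simp only [Equiv.subLeft_apply, hterm]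
  rw [sum_pr]
  refine Finset.sum_congr rfl fun x _ => ?_
  congr 2
  have hz : zeros x = (Finset.univ.filter fun i => x (m - 1 - i) = false).card := by
    rw [zeros_eq_card, Finset.card_filter, Finset.card_filter]
    exact ((Equiv.subLeft (m - 1)).sum_comp fun i => if x i = false then 1 else 0).symm
  rw [hz, ← card_filter_rank_lt]
  congr 1
  ext d
  simp only [Finset.mem_filter, Finset.mem_univ, true_and, Finset.filter_filter]
  rw [and_comm]
  simp only [and_comm]

/-- With a common rate limit `r`, assigning `r(1-p_{i-1})/α` units of flow to the cyclic-shift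
strategy starting at `i` (with `α = ∑_{t=1}^k P(Z ≥ t)`) saturates every processor, and the
resulting routing is optimal: no feasible conservative routing has larger throughput. -/
theorem stmt_8 (n k : ℕ) [NeZero n] (hk1 : 1 ≤ k) (hkn : k ≤ n) (p : Fin n → ℝ)
    (hp : ∀ i, 0 < p i ∧ p i < 1) (r : ℝ) (hr : 0 < r) :
    (∀ m : Fin n,
      ∑ s : Fin n, (r * (1 - p (s - 1)) / ∑ t ∈ Finset.Icc 1 k, pr p (fun x => t ≤ zeros x)) *
          gprob p (permStrat k (Equiv.addLeft s)) m = r) ∧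
    (∀ (S : Finset (DTree n)) (z : DTree n → ℝ),
      (∀ T ∈ S, Conservative k T) → (∀ T, 0 ≤ z T) →
      (∀ i, ∑ T ∈ S, gprob p T i * z T ≤ r) →
      ∑ T ∈ S, z T
        ≤ ∑ s : Fin n, r * (1 - p (s - 1)) /
            ∑ t ∈ Finset.Icc 1 k, pr p (fun x => t ≤ zeros x)) := by
  set α := ∑ t ∈ Finset.Icc 1 k, pr p (fun x => t ≤ zeros x) with hα
  have hpos : 0 < α := sum_pr_le_zeros_pos hk1 hp
  refine ⟨fun m => ?_, fun S z hS hz hload => ?_⟩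
  · calc ∑ s : Fin n, (r * (1 - p (s - 1)) / α) * gprob p (permStrat k (Equiv.addLeft s)) m
        = r / α * ∑ s : Fin n, (1 - p (s - 1)) * gprob p (permStrat k (Equiv.addLeft s)) m := by
          rw [Finset.mul_sum]
          exact Finset.sum_congr rfl fun s _ => by ring
      _ = r := by
          rw [sum_gprob_cyclic, ← hα]
          field_simp
  · have hshift : ∑ s : Fin n, r * (1 - p (s - 1)) = ∑ i, r * (1 - p i) :=
      (Equiv.subRight (1 : Fin n)).sum_comp fun i => r * (1 - p i)
    rw [← Finset.sum_div, hshift, le_div_iff₀ hpos]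
    calc (∑ T ∈ S, z T) * α
        = ∑ T ∈ S, ∑ i, (1 - p i) * (gprob p T i * z T) := by
          rw [Finset.sum_mul]
          refine Finset.sum_congr rfl fun T hT => ?_
          rw [hα, ← (hS T hT).sum_gprob p, Finset.mul_sum]
          exact Finset.sum_congr rfl fun i _ => by ring
      _ = ∑ i, (1 - p i) * ∑ T ∈ S, gprob p T i * z T := by
          rw [Finset.sum_comm]
          exact Finset.sum_congr rfl fun i _ => (Finset.mul_sum _ _ _).symm
      _ ≤ ∑ i, r * (1 - p i) := by
          refine Finset.sum_le_sum fun i _ => ?_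
          rw [mul_comm r]
          exact mul_le_mul_of_nonneg_left (hload i) (by linarith [(hp i).2])
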